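/- The infimum over natural numbers n ≥ 1 of 2 · binom(2n+2, n) / binom(2n, n)^{1 + 2/n} equals 1/2; equivalently, the supremum over n ≥ 1 of D_n := (1/√2) · binom(2n,n)^{1/2+1/n} / binom(2n+2,n)^{1/2} equals √2. -/

import Mathlib

open Filter Topology

noncomputable def fS (n : ℕ) : ℝ :=
  2 * (Nat.choose (2 * n + 2) n : ℝ) / (Nat.choose (2 * n) n : ℝ) ^ ((1 : ℝ) + 2 / (n : ℝ))

lemma choose_rel (n : ℕ) :
    (Nat.choose (2 * n + 2) n : ℝ) * (n + 2) = (4 * n + 2) * (Nat.choose (2 * n) n : ℝ) := by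
  have h1 := Nat.add_one_mul_choose_eq (2 * n + 1) (n + 1)
  have h2 := Nat.add_one_mul_choose_eq (2 * n) n
  have e1 : (2 * n + 1).choose (n + 1) = (2 * n + 1).choose n :=
    Nat.choose_symm_of_eq_add (by ring)
  have e2 : (2 * n + 1 + 1).choose (n + 1 + 1) = (2 * n + 2).choose n :=
    Nat.choose_symm_of_eq_add (by ring)
  rw [e2] at h1
  have h1' : ((2 * n + 1 + 1 : ℝ)) * ((2 * n + 1).choose (n + 1) : ℝ)
      = ((2 * n + 2).choose n : ℝ) * (n + 1 + 1) := by exact_mod_cast h1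
  have h2' : ((2 * n + 1 : ℝ)) * ((2 * n).choose n : ℝ)
      = ((2 * n + 1).choose (n + 1) : ℝ) * (n + 1) := by exact_mod_cast h2
  linear_combination -h1' - 2 * h2'

lemma central_bound (n : ℕ) (hn : 2 ≤ n) : 8 * Nat.centralBinom n ≤ 3 * 4 ^ n := by
  induction n, hn using Nat.le_induction with
  | base => decide
  | succ k hk ih =>
    have h := Nat.succ_mul_centralBinom_succ k
    have : (k + 1) * (8 * Nat.centralBinom (k + 1)) ≤ (k + 1) * (3 * 4 ^ (k + 1)) := by
      have h3 : (k + 1) * (8 * Nat.centralBinom (k + 1)) 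
          = 2 * (2 * k + 1) * (8 * Nat.centralBinom k) := by
        linear_combination 8 * h
      rw [h3]
      calc _ ≤ (4 * (k + 1)) * (3 * 4 ^ k) := Nat.mul_le_mul (by omega) ih
        _ = _ := by ring
    exact Nat.le_of_mul_le_mul_left this (by omega)

lemma sq_bound (n : ℕ) (hn : 1 ≤ n) :
    (Nat.choose (2 * n) n : ℝ) ^ 2 ≤ ((16 * n + 8) / (n + 2) : ℝ) ^ n := by
  rcases Nat.lt_or_ge n 2 with h | h
  · obtain rfl : n = 1 := by omega
    norm_num [Nat.choose]
  have hb : 8 * (Nat.choose (2 * n) n : ℝ) ≤ 3 * 4 ^ n := by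
    rw [← Nat.centralBinom_eq_two_mul_choose]
    exact_mod_cast central_bound n h
  have hx : (1 + 3 / (2 * n + 1) : ℝ) ^ n ≤ 64 / 9 := by
    have h1 : (1 + 3 / (2 * n + 1) : ℝ) ≤ Real.exp (3 / (2 * n + 1)) := by
      have := Real.add_one_le_exp (3 / (2 * n + 1) : ℝ)
      linarith
    have h2 : (1 + 3 / (2 * n + 1) : ℝ) ^ n ≤ Real.exp (3 / (2 * n + 1)) ^ n :=
      pow_le_pow_left₀ (by positivity) h1 n
    rw [← Real.exp_nat_mul] at h2
    have h3 : (n * (3 / (2 * n + 1)) : ℝ) ≤ 3 / 2 := by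
      rw [mul_div_assoc', div_le_div_iff₀ (by positivity) (by norm_num)]
      linarith
    have h4 : Real.exp (3 / 2) ≤ 64 / 9 := by
      refine le_of_pow_le_pow_left₀ two_ne_zero (by norm_num) ?_
      rw [← Real.exp_nat_mul]
      have : ((2 : ℕ) * (3 / 2) : ℝ) = (3 : ℕ) * 1 := by norm_num
      rw [this, Real.exp_nat_mul]
      calc Real.exp 1 ^ 3 ≤ 3 ^ 3 := 
            pow_le_pow_left₀ (Real.exp_pos _).le (by linarith [Real.exp_one_lt_d9]) 3
        _ ≤ _ := by norm_num
    exact h2.trans ((Real.exp_le_exp.2 h3).trans h4)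
  have e : ((16 * n + 8) / (n + 2) : ℝ) * (1 + 3 / (2 * n + 1)) = 16 := by
    field_simp
    ring
  have e2 : ((16 * n + 8) / (n + 2) : ℝ) ^ n * (1 + 3 / (2 * n + 1)) ^ n = 16 ^ n := by
    rw [← mul_pow, e]
  have hp : (0 : ℝ) ≤ ((16 * n + 8) / (n + 2) : ℝ) ^ n := by positivity
  have h5 : (16 : ℝ) ^ n ≤ ((16 * n + 8) / (n + 2) : ℝ) ^ n * (64 / 9) := by
    rw [← e2]; exact mul_le_mul_of_nonneg_left hx hp
  have h6 : (8 * (Nat.choose (2 * n) n : ℝ)) ^ 2 ≤ (3 * 4 ^ n) ^ 2 :=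
    pow_le_pow_left₀ (by positivity) hb 2
  have h7 : (3 * 4 ^ n : ℝ) ^ 2 = 9 * 16 ^ n := by
    rw [mul_pow, ← pow_mul, mul_comm n 2, pow_mul]; norm_num
  rw [h7] at h6
  nlinarith

lemma choose_pos' (n : ℕ) : (0 : ℝ) < (Nat.choose (2 * n) n : ℝ) := by
  exact_mod_cast Nat.choose_pos (by omega)

lemma fS_eq (n : ℕ) :
    fS n = (8 * n + 4) / (n + 2) / (Nat.choose (2 * n) n : ℝ) ^ (2 / (n : ℝ)) := by
  have hc := choose_pos' n
  have hp := Real.rpow_pos_of_pos hc (2 / (n : ℝ))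
  have h := choose_rel n
  unfold fS
  rw [Real.rpow_add hc, Real.rpow_one, div_div, div_eq_div_iff (by positivity) (by positivity)]
  linear_combination 2 * (Nat.choose (2 * n) n : ℝ) ^ (2 / (n : ℝ)) * h

lemma fS_lower (n : ℕ) (hn : 1 ≤ n) : 1 / 2 ≤ fS n := by
  have hc := choose_pos' n
  have hp := Real.rpow_pos_of_pos hc (2 / (n : ℝ))
  have hn0 : (n : ℝ) ≠ 0 := by positivity
  have h : (Nat.choose (2 * n) n : ℝ) ^ (2 / (n : ℝ)) ≤ (16 * n + 8) / (n + 2) := by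
    have := Real.rpow_le_rpow (by positivity) (sq_bound n hn) (z := 1 / (n : ℝ)) (by positivity)
    rw [← Real.rpow_natCast, ← Real.rpow_natCast, ← Real.rpow_mul hc.le,
      ← Real.rpow_mul (by positivity), mul_one_div_cancel hn0, Real.rpow_one] at this
    convert this using 2
    push_cast; ring
  rw [fS_eq, le_div_iff₀ hp]
  calc _ ≤ 1 / 2 * ((16 * n + 8) / (n + 2) : ℝ) := by linarith
    _ = _ := by ring

lemma fS_upper (n : ℕ) (hn : 1 ≤ n) :
    fS n ≤ (8 - 12 / ((n + 2 : ℕ) : ℝ)) / 16 * (((2 * n : ℕ) : ℝ) ^ (1 / ((2 * n : ℕ) : ℝ))) ^ 4 := by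
  have hc := choose_pos' n
  have hp := Real.rpow_pos_of_pos hc (2 / (n : ℝ))
  have hn0 : (n : ℝ) ≠ 0 := by positivity
  have hb : (4 : ℝ) ^ n ≤ (2 * n : ℕ) * (Nat.choose (2 * n) n : ℝ) := by
    have := Nat.four_pow_le_two_mul_self_mul_centralBinom n (by omega)
    rw [Nat.centralBinom_eq_two_mul_choose] at this
    exact_mod_cast this
  have h := Real.rpow_le_rpow (by positivity) hb (z := 2 / (n : ℝ)) (by positivity)
  rw [Real.mul_rpow (by positivity) hc.le, ← Real.rpow_natCast, ← Real.rpow_mul (by norm_num),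
    mul_div_cancel₀ _ hn0] at h
  have e : (((2 * n : ℕ) : ℝ) ^ (1 / ((2 * n : ℕ) : ℝ))) ^ 4 = ((2 * n : ℕ) : ℝ) ^ (2 / (n : ℝ)) := by
    rw [← Real.rpow_natCast, ← Real.rpow_mul (by positivity)]
    congr 1
    push_cast
    field_simp
    norm_num
  have e4 : (4 : ℝ) ^ (2 : ℝ) = 16 := by norm_num
  rw [e4] at h
  rw [e, fS_eq, div_le_iff₀ hp, mul_assoc]
  have e5 : (8 - 12 / ((n + 2 : ℕ) : ℝ)) = (8 * n + 4) / (n + 2) := by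
    push_cast; field_simp; ring
  rw [e5]
  have : (0 : ℝ) ≤ (8 * n + 4) / (n + 2) / 16 := by positivity
  calc _ = ((8 * n + 4) / (n + 2) / 16 : ℝ) * 16 := by ring
    _ ≤ _ := mul_le_mul_of_nonneg_left h this

lemma fS_tendsto : Tendsto fS atTop (𝓝 (1 / 2)) := by
  have h1 : Tendsto (fun n : ℕ => (12 : ℝ) / ((n + 2 : ℕ) : ℝ)) atTop (𝓝 0) :=
    (tendsto_const_div_atTop_nhds_zero_nat 12).comp (tendsto_add_atTop_nat 2)
  have h2 : Tendsto (fun n : ℕ => (((2 * n : ℕ) : ℝ) ^ (1 / ((2 * n : ℕ) : ℝ)))) atTop (𝓝 1) :=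
    tendsto_rpow_div.comp (tendsto_natCast_atTop_atTop.comp
      (tendsto_id.const_mul_atTop' (by norm_num : 0 < 2)))
  have h3 := ((h1.const_sub 8).div_const 16).mul (h2.pow 4)
  norm_num only [] at h3
  refine tendsto_of_tendsto_of_tendsto_of_le_of_le' tendsto_const_nhds (by simpa using h3) ?_ ?_
  · filter_upwards [eventually_ge_atTop 1] with n hn using by simpa using fS_lower n hn
  · filter_upwards [eventually_ge_atTop 1] with n hn using by simpa using fS_upper n hn

lemma D_eq (n : ℕ) : (1 / Real.sqrt 2) *
          (Nat.choose (2 * n) n : ℝ) ^ ((1 : ℝ) / 2 + 1 / (n : ℝ)) /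
          (Nat.choose (2 * n + 2) n : ℝ) ^ ((1 : ℝ) / 2) = (Real.sqrt (fS n))⁻¹ := by
  have hc := choose_pos' n
  have e : (Nat.choose (2 * n) n : ℝ) ^ ((1 : ℝ) / 2 + 1 / (n : ℝ))
      = Real.sqrt ((Nat.choose (2 * n) n : ℝ) ^ ((1 : ℝ) + 2 / (n : ℝ))) := by
    rw [Real.sqrt_eq_rpow, ← Real.rpow_mul hc.le]
    congr 1
    ring
  rw [e, ← Real.sqrt_eq_rpow, fS, Real.sqrt_div (by positivity), Real.sqrt_mul (by norm_num),
    inv_div]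
  ring


/-- The infimum over `n ≥ 1` of `2·binom(2n+2,n)/binom(2n,n)^(1+2/n)`
is `1/2`; equivalently, the supremum over `n ≥ 1` of
`D_n = (1/√2)·binom(2n,n)^(1/2+1/n)/binom(2n+2,n)^(1/2)` is `√2`. -/
theorem statement19 :
    (⨅ n : {m : ℕ // 1 ≤ m},
        2 * (Nat.choose (2 * (n : ℕ) + 2) (n : ℕ) : ℝ) /
          (Nat.choose (2 * (n : ℕ)) (n : ℕ) : ℝ) ^ ((1 : ℝ) + 2 / ((n : ℕ) : ℝ))) =
      1 / 2 ∧
    (⨆ n : {m : ℕ // 1 ≤ m},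
        (1 / Real.sqrt 2) *
          (Nat.choose (2 * (n : ℕ)) (n : ℕ) : ℝ) ^ ((1 : ℝ) / 2 + 1 / ((n : ℕ) : ℝ)) /
          (Nat.choose (2 * (n : ℕ) + 2) (n : ℕ) : ℝ) ^ ((1 : ℝ) / 2)) =
      Real.sqrt 2 := by
  have hsub : ∀ {P : ℕ → Prop}, (∀ n : {m : ℕ // 1 ≤ m}, P n) → ∀ᶠ n in atTop, P n := by
    intro P h
    filter_upwards [eventually_ge_atTop 1] with n hn using h ⟨n, hn⟩
  have : Nonempty {m : ℕ // 1 ≤ m} := ⟨⟨1, le_rfl⟩⟩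
  constructor
  · change (⨅ n : {m : ℕ // 1 ≤ m}, fS n) = 1 / 2
    have hb : BddBelow (Set.range fun n : {m : ℕ // 1 ≤ m} => fS n) :=
      ⟨1 / 2, by rintro _ ⟨n, rfl⟩; exact fS_lower n n.2⟩
    refine le_antisymm ?_ (le_ciInf fun n => fS_lower n n.2)
    exact ge_of_tendsto fS_tendsto (hsub fun n => ciInf_le hb n)
  · simp only [D_eq]
    have e : Real.sqrt 2 = (Real.sqrt (1 / 2))⁻¹ := by
      rw [← Real.sqrt_inv]; norm_num
    rw [e]
    have hle : ∀ n : {m : ℕ // 1 ≤ m}, (Real.sqrt (fS n))⁻¹ ≤ (Real.sqrt (1 / 2))⁻¹ := fun n =>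
      inv_anti₀ (Real.sqrt_pos.2 (by norm_num)) (Real.sqrt_le_sqrt (fS_lower n n.2))
    have hb : BddAbove (Set.range fun n : {m : ℕ // 1 ≤ m} => (Real.sqrt (fS n))⁻¹) :=
      ⟨_, by rintro _ ⟨n, rfl⟩; exact hle n⟩
    refine le_antisymm (ciSup_le hle) ?_
    have ht : Tendsto (fun n => (Real.sqrt (fS n))⁻¹) atTop (𝓝 (Real.sqrt (1 / 2))⁻¹) :=
      fS_tendsto.sqrt.inv₀ (Real.sqrt_pos.2 (by norm_num)).ne'
    exact le_of_tendsto ht (hsub fun n => le_ciSup hb n)
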